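/- (Moment estimate on the multislice.) For every function f : Ω_κ → ℝ and every p ≥ 2, ‖f − E_κ f‖_{L^p(P_κ)} ≤ √(4θp) · ‖Γ(f)‖_{L^p(P_κ)}, where θ = √e/(√e − 1). -/

import Mathlib

open Finset Real
open scoped Classical

noncomputable section

/-- The multislice `Ω_κ ⊆ 𝒳^N`: vectors with values in `{x ℓ}` where the value `x ℓ`
appears exactly `κ ℓ` times. -/
def multislice (L N : ℕ) (κ : Fin L → ℕ) (x : Fin L → ℝ) : Finset (Fin N → ℝ) :=
  (Fintype.piFinset fun _ : Fin N => Finset.image x Finset.univ).filter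
    (fun ω => ∀ ℓ : Fin L, (Finset.univ.filter fun i => ω i = x ℓ).card = κ ℓ)

/-- Expectation with respect to the uniform distribution on a finite set. -/
def uexpect {α : Type*} (Ω : Finset α) (f : α → ℝ) : ℝ := (∑ ω ∈ Ω, f ω) / Ω.card

/-- Probability of an event with respect to the uniform distribution on a finite set. -/
def uprob {α : Type*} (Ω : Finset α) (p : α → Prop) : ℝ :=
  ((Ω.filter p).card : ℝ) / Ω.card

/-- The entropy functional `Ent_μ(g) = E_μ[g log g] − (E_μ g) log (E_μ g)` with respect to
the uniform distribution on a finite set. -/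
def uent {α : Type*} (Ω : Finset α) (g : α → ℝ) : ℝ :=
  uexpect Ω (fun ω => g ω * Real.log (g ω)) - uexpect Ω g * Real.log (uexpect Ω g)

/-- `Γ(f)² (ω) = (1/(2N)) ∑_{i<j} (f(ω) − f(τ_ij ω))²`. -/
def gammaSq {N : ℕ} (f : (Fin N → ℝ) → ℝ) (ω : Fin N → ℝ) : ℝ :=
  (1 / (2 * (N : ℝ))) * ∑ q ∈ (Finset.univ : Finset (Fin N × Fin N)).filter
    (fun q => q.1 < q.2), (f ω - f (ω ∘ Equiv.swap q.1 q.2)) ^ 2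

/-- `Γ⁺(f)² (ω) = (1/(2N)) ∑_{i<j} ((f(ω) − f(τ_ij ω))₊)²`. -/
def gammaPlusSq {N : ℕ} (f : (Fin N → ℝ) → ℝ) (ω : Fin N → ℝ) : ℝ :=
  (1 / (2 * (N : ℝ))) * ∑ q ∈ (Finset.univ : Finset (Fin N × Fin N)).filter
    (fun q => q.1 < q.2), (max (f ω - f (ω ∘ Equiv.swap q.1 q.2)) 0) ^ 2


/-- The permutations of `α` that fix every point outside `S`. -/
def permsOn {α : Type*} [Fintype α] [DecidableEq α] (S : Finset α) : Finset (Equiv.Perm α) :=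
  Finset.univ.filter fun σ => ∀ a ∉ S, σ a = a

/-- The average of `f` over all rearrangements of the coordinates indexed by `S`. -/
def permAvg {α β : Type*} [Fintype α] [DecidableEq α] (S : Finset α) (f : (α → β) → ℝ)
    (ω : α → β) : ℝ :=
  (∑ σ ∈ permsOn S, f (ω ∘ σ)) / (permsOn S).card

lemma sum_comp_perm {α β : Type*} {Ω : Finset (α → β)} (hΩ : ∀ ω ∈ Ω, ∀ σ : Equiv.Perm α, ω ∘ σ ∈ Ω)
    (σ : Equiv.Perm α) (f : (α → β) → ℝ) : ∑ ω ∈ Ω, f (ω ∘ σ) = ∑ ω ∈ Ω, f ω := by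
  refine Finset.sum_bij' (fun ω _ => ω ∘ σ) (fun ω _ => ω ∘ (σ⁻¹ : Equiv.Perm α))
    (fun ω h => hΩ ω h σ) (fun ω h => hΩ ω h σ⁻¹) ?_ ?_ fun _ _ => rfl
  · intro ω _; ext a; simp
  · intro ω _; ext a; simp

section PermAvg

variable {α β : Type*} [Fintype α] [DecidableEq α]

lemma mem_permsOn {S : Finset α} {σ : Equiv.Perm α} :
    σ ∈ permsOn S ↔ ∀ a ∉ S, σ a = a := by
  simp [permsOn]

lemma one_mem_permsOn (S : Finset α) : (1 : Equiv.Perm α) ∈ permsOn S := by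
  simp [mem_permsOn]

lemma card_permsOn_pos (S : Finset α) : (0 : ℝ) < (permsOn S).card := by
  exact_mod_cast Finset.card_pos.2 ⟨1, one_mem_permsOn S⟩

lemma inv_apply_mem_of_mem_permsOn {S : Finset α} {σ : Equiv.Perm α} (hσ : σ ∈ permsOn S)
    {a : α} (ha : a ∉ S) : σ⁻¹ a = a := by
  rw [Equiv.Perm.inv_eq_iff_eq, mem_permsOn.1 hσ a ha]

lemma apply_mem_of_mem_permsOn {S : Finset α} {σ : Equiv.Perm α} (hσ : σ ∈ permsOn S)
    {a : α} (ha : a ∈ S) : σ a ∈ S := by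
  by_contra h
  have := mem_permsOn.1 hσ _ h
  exact h (by rwa [σ.injective this])

lemma permsOn_empty : permsOn (∅ : Finset α) = {1} := by
  ext σ
  simp [mem_permsOn, Equiv.ext_iff]

/-- Coset decomposition of the permutations of `S` along the image of `i`. -/
lemma sum_permsOn {S : Finset α} {i : α} (hi : i ∈ S) (F : Equiv.Perm α → ℝ) :
    ∑ σ ∈ permsOn S, F σ =
      ∑ j ∈ S, ∑ σ ∈ permsOn (S.erase i), F (Equiv.swap i j * σ) := by
  rw [← Finset.sum_product']
  symm
  refine Finset.sum_bij' (fun x _ => Equiv.swap i x.1 * x.2)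
    (fun ρ _ => (ρ i, Equiv.swap i (ρ i) * ρ)) ?_ ?_ ?_ ?_ ?_
  · rintro ⟨j, σ⟩ h
    obtain ⟨hj, hσ⟩ := Finset.mem_product.1 h
    refine mem_permsOn.2 fun a ha => ?_
    have hai : a ≠ i := fun h => ha (h ▸ hi)
    have haj : a ≠ j := fun h => ha (h ▸ hj)
    simp [mem_permsOn.1 hσ a (by simp [ha]), Equiv.swap_apply_of_ne_of_ne hai haj]
  · intro ρ hρ
    refine Finset.mem_product.2 ⟨apply_mem_of_mem_permsOn hρ hi, mem_permsOn.2 fun a ha => ?_⟩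
    by_cases hai : a = i
    · simp [hai]
    · have haS : a ∉ S := fun h => ha (Finset.mem_erase.2 ⟨hai, h⟩)
      have hρa := mem_permsOn.1 hρ a haS
      have : a ≠ ρ i := fun h => haS (h ▸ apply_mem_of_mem_permsOn hρ hi)
      simp [hρa, Equiv.swap_apply_of_ne_of_ne hai this]
  · rintro ⟨j, σ⟩ h
    obtain ⟨hj, hσ⟩ := Finset.mem_product.1 h
    have : σ i = i := mem_permsOn.1 hσ i (by simp)
    simp [this, ← mul_assoc]
  · intro ρ hρ
    simp [← mul_assoc]
  · intro x hx
    rfl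

lemma card_permsOn {S : Finset α} {i : α} (hi : i ∈ S) :
    ((permsOn S).card : ℝ) = S.card * (permsOn (S.erase i)).card := by
  simpa using sum_permsOn hi fun _ => 1

lemma permAvg_eq_sum_erase {S : Finset α} {i : α} (hi : i ∈ S) (f : (α → β) → ℝ) (ω : α → β) :
    permAvg S f ω = (∑ j ∈ S, permAvg (S.erase i) f (ω ∘ Equiv.swap i j)) / S.card := by
  simp only [permAvg]
  rw [sum_permsOn hi, card_permsOn hi, ← Finset.sum_div, div_div, mul_comm]
  rfl

lemma permAvg_empty (f : (α → β) → ℝ) (ω : α → β) : permAvg ∅ f ω = f ω := by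
  simp [permAvg, permsOn_empty]

lemma permAvg_eq_weighted_sum (S : Finset α) (f : (α → β) → ℝ) (ω : α → β) :
    permAvg S f ω = ∑ σ ∈ permsOn S, ((permsOn S).card : ℝ)⁻¹ • f (ω ∘ σ) := by
  simp [permAvg, ← Finset.mul_sum, div_eq_inv_mul]

lemma permAvg_mem {I : Set ℝ} (hI : Convex ℝ I) {Ω : Finset (α → β)}
    (hΩ : ∀ ω ∈ Ω, ∀ σ : Equiv.Perm α, ω ∘ σ ∈ Ω) {f : (α → β) → ℝ} (hf : ∀ ω ∈ Ω, f ω ∈ I)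
    (S : Finset α) {ω : α → β} (hω : ω ∈ Ω) : permAvg S f ω ∈ I := by
  rw [permAvg_eq_weighted_sum]
  refine hI.sum_mem (fun _ _ => by positivity) ?_ fun σ _ => hf _ (hΩ ω hω σ)
  simp [(card_permsOn_pos S).ne']

/-- Averaging one more coordinate costs at most the transpositions through that coordinate. -/
lemma sum_permAvg_erase_sub_le {Ω : Finset (α → β)}
    (hΩ : ∀ ω ∈ Ω, ∀ σ : Equiv.Perm α, ω ∘ σ ∈ Ω) {I : Set ℝ} {φ ψ : ℝ → ℝ}
    (htan : ∀ x ∈ I, ∀ y ∈ I, φ x - φ y ≤ ψ x * (x - y))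
    (hI : Convex ℝ I)
    (hconv : ConvexOn ℝ (I ×ˢ I) fun z : ℝ × ℝ => (ψ z.1 - ψ z.2) * (z.1 - z.2))
    {f : (α → β) → ℝ} (hf : ∀ ω ∈ Ω, f ω ∈ I) {S : Finset α} {i : α} (hi : i ∈ S) :
    ∑ ω ∈ Ω, φ (permAvg (S.erase i) f ω) - ∑ ω ∈ Ω, φ (permAvg S f ω) ≤
      (∑ j ∈ S, ∑ ω ∈ Ω, (ψ (f ω) - ψ (f (ω ∘ Equiv.swap i j))) *
        (f ω - f (ω ∘ Equiv.swap i j))) / (2 * S.card) := by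
  set g := permAvg (S.erase i) f with hg
  set Ψ : ℝ × ℝ → ℝ := fun z => (ψ z.1 - ψ z.2) * (z.1 - z.2) with hΨ
  have hk : (0 : ℝ) < S.card := by exact_mod_cast Finset.card_pos.2 ⟨i, hi⟩
  have hgI : ∀ ω ∈ Ω, g ω ∈ I := fun ω hω => permAvg_mem hI hΩ hf _ hω
  have hsymm : ∀ j, ∑ ω ∈ Ω, ψ (g ω) * (g ω - g (ω ∘ Equiv.swap i j)) =
      (∑ ω ∈ Ω, Ψ (g ω, g (ω ∘ Equiv.swap i j))) / 2 := by
    intro j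
    have h := sum_comp_perm hΩ (Equiv.swap i j)
      fun ω => ψ (g ω) * (g ω - g (ω ∘ Equiv.swap i j))
    have hinv : ∀ ω : α → β, (ω ∘ Equiv.swap i j) ∘ Equiv.swap i j = ω := by
      intro ω; ext a; simp
    simp only [hinv] at h
    rw [eq_div_iff two_ne_zero, mul_two]
    nth_rewrite 2 [← h]
    rw [← Finset.sum_add_distrib]
    exact Finset.sum_congr rfl fun ω _ => by simp only [hΨ]; ring
  have hjensen : ∀ j, ∀ ω ∈ Ω, Ψ (g ω, g (ω ∘ Equiv.swap i j)) ≤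
      (∑ σ ∈ permsOn (S.erase i),
        Ψ (f (ω ∘ σ), f ((ω ∘ σ) ∘ Equiv.swap i (σ⁻¹ j)))) / (permsOn (S.erase i)).card := by
    intro j ω hω
    have h := hconv.map_sum_le (t := permsOn (S.erase i))
      (w := fun _ => ((permsOn (S.erase i)).card : ℝ)⁻¹)
      (p := fun σ => (f (ω ∘ σ), f ((ω ∘ Equiv.swap i j) ∘ σ)))
      (fun _ _ => by positivity) (by simp [(card_permsOn_pos (S.erase i)).ne'])
      (fun σ _ => ⟨hf _ (hΩ _ hω _), hf _ (hΩ _ (hΩ _ hω _) _)⟩)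
    have hz : ∑ σ ∈ permsOn (S.erase i), ((permsOn (S.erase i)).card : ℝ)⁻¹ •
        (f (ω ∘ σ), f ((ω ∘ Equiv.swap i j) ∘ σ)) = (g ω, g (ω ∘ Equiv.swap i j)) := by
      ext
      · simp [Prod.fst_sum, hg, permAvg_eq_weighted_sum]
      · simp [Prod.snd_sum, hg, permAvg_eq_weighted_sum]
    rw [hz] at h
    refine h.trans_eq ?_
    rw [div_eq_inv_mul, Finset.mul_sum]
    refine Finset.sum_congr rfl fun σ hσ => ?_
    have hσi : σ⁻¹ i = i := inv_apply_mem_of_mem_permsOn hσ (by simp)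
    have hcomm : (ω ∘ Equiv.swap i j) ∘ σ = (ω ∘ σ) ∘ Equiv.swap i (σ⁻¹ j) := by
      have := Equiv.swap_mul_eq_mul_swap σ i j
      rw [hσi] at this
      ext a
      exact congrArg ω (Equiv.congr_fun this a)
    simp only [hcomm, smul_eq_mul]
  have hreindex : ∑ j ∈ S, ∑ ω ∈ Ω, (∑ σ ∈ permsOn (S.erase i),
        Ψ (f (ω ∘ σ), f ((ω ∘ σ) ∘ Equiv.swap i (σ⁻¹ j)))) / (permsOn (S.erase i)).card =
      ∑ j ∈ S, ∑ ω ∈ Ω, Ψ (f ω, f (ω ∘ Equiv.swap i j)) := by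
    simp only [← Finset.sum_div]
    rw [div_eq_iff (card_permsOn_pos _).ne']
    have h1 : ∀ j ∈ S, ∑ ω ∈ Ω, ∑ σ ∈ permsOn (S.erase i),
        Ψ (f (ω ∘ σ), f ((ω ∘ σ) ∘ Equiv.swap i (σ⁻¹ j))) =
        ∑ σ ∈ permsOn (S.erase i), ∑ ω ∈ Ω, Ψ (f ω, f (ω ∘ Equiv.swap i (σ⁻¹ j))) := by
      intro j _
      rw [Finset.sum_comm]
      exact Finset.sum_congr rfl fun σ _ =>
        sum_comp_perm hΩ σ fun ω => Ψ (f ω, f (ω ∘ Equiv.swap i (σ⁻¹ j)))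
    rw [Finset.sum_congr rfl h1, Finset.sum_comm, mul_comm, ← nsmul_eq_mul, ← Finset.sum_const]
    refine Finset.sum_congr rfl fun σ hσ => ?_
    have hS : ∀ a, a ∈ S → σ a ∈ S := by
      intro a ha
      by_cases hai : a = i
      · rw [hai, mem_permsOn.1 hσ i (by simp)]; exact hi
      · exact Finset.mem_of_mem_erase
          (apply_mem_of_mem_permsOn hσ (Finset.mem_erase.2 ⟨hai, ha⟩))
    have hS' : ∀ a, a ∈ S → σ⁻¹ a ∈ S := by
      intro a ha
      by_contra hc
      have := mem_permsOn.1 hσ (σ⁻¹ a) fun h => hc (Finset.mem_of_mem_erase h)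
      have hfix : a = σ⁻¹ a := (σ.apply_symm_apply a).symm.trans this
      exact hc (hfix ▸ ha)
    exact Finset.sum_bij' (fun a _ => σ⁻¹ a) (fun a _ => σ a) hS' hS
      (fun a _ => by simp) (fun a _ => by simp) fun a _ => rfl
  calc ∑ ω ∈ Ω, φ (g ω) - ∑ ω ∈ Ω, φ (permAvg S f ω)
      ≤ ∑ ω ∈ Ω, ψ (g ω) * (g ω - permAvg S f ω) := by
        rw [← Finset.sum_sub_distrib]
        exact Finset.sum_le_sum fun ω hω =>
          htan _ (hgI ω hω) _ (permAvg_mem hI hΩ hf _ hω)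
    _ = (∑ j ∈ S, ∑ ω ∈ Ω, ψ (g ω) * (g ω - g (ω ∘ Equiv.swap i j))) / S.card := by
        rw [Finset.sum_comm, Finset.sum_div]
        refine Finset.sum_congr rfl fun ω _ => ?_
        rw [permAvg_eq_sum_erase hi, ← Finset.mul_sum, Finset.sum_sub_distrib, Finset.sum_const,
          nsmul_eq_mul, ← hg]
        field_simp
    _ = (∑ j ∈ S, ∑ ω ∈ Ω, Ψ (g ω, g (ω ∘ Equiv.swap i j))) / (2 * S.card) := by
        simp only [hsymm, ← Finset.sum_div]
        rw [div_div]
    _ ≤ (∑ j ∈ S, ∑ ω ∈ Ω, Ψ (f ω, f (ω ∘ Equiv.swap i j))) / (2 * S.card) := by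
        rw [← hreindex]
        gcongr with j _ ω hω
        exact hjensen j ω hω

/-- A `φ`-entropy inequality for random transpositions of the coordinates in `S`. -/
lemma sum_sub_sum_permAvg_le {Ω : Finset (α → β)}
    (hΩ : ∀ ω ∈ Ω, ∀ σ : Equiv.Perm α, ω ∘ σ ∈ Ω) {I : Set ℝ} {φ ψ : ℝ → ℝ}
    (htan : ∀ x ∈ I, ∀ y ∈ I, φ x - φ y ≤ ψ x * (x - y))
    (hI : Convex ℝ I)
    (hconv : ConvexOn ℝ (I ×ˢ I) fun z : ℝ × ℝ => (ψ z.1 - ψ z.2) * (z.1 - z.2))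
    {f : (α → β) → ℝ} (hf : ∀ ω ∈ Ω, f ω ∈ I) (S : Finset α) :
    ∑ ω ∈ Ω, φ (f ω) - ∑ ω ∈ Ω, φ (permAvg S f ω) ≤
      (∑ i ∈ S, ∑ j ∈ S, ∑ ω ∈ Ω, (ψ (f ω) - ψ (f (ω ∘ Equiv.swap i j))) *
        (f ω - f (ω ∘ Equiv.swap i j))) / (2 * S.card) := by
  set D : α → α → ℝ := fun i j => ∑ ω ∈ Ω, (ψ (f ω) - ψ (f (ω ∘ Equiv.swap i j))) *
        (f ω - f (ω ∘ Equiv.swap i j)) with hD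
  have hDself : ∀ i, D i i = 0 := fun i => by simp [hD]
  have hDcomm : ∀ i j, D i j = D j i := fun i j => by simp only [hD, Equiv.swap_comm i j]
  have hDnonneg : ∀ i j, 0 ≤ D i j := by
    intro i j
    refine Finset.sum_nonneg fun ω hω => ?_
    have h1 := htan _ (hf _ hω) _ (hf _ (hΩ ω hω (Equiv.swap i j)))
    have h2 := htan _ (hf _ (hΩ ω hω (Equiv.swap i j))) _ (hf _ hω)
    linarith
  change _ ≤ (∑ i ∈ S, ∑ j ∈ S, D i j) / (2 * S.card)
  induction hn : S.card generalizing S with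
  | zero =>
    rw [Finset.card_eq_zero] at hn
    simp [hn, permAvg_empty]
  | succ n ih =>
    have hTnonneg : 0 ≤ ∑ i ∈ S, ∑ j ∈ S, D i j :=
      Finset.sum_nonneg fun _ _ => Finset.sum_nonneg fun _ _ => hDnonneg _ _
    set T := ∑ i ∈ S, ∑ j ∈ S, D i j with hT
    set H := ∑ ω ∈ Ω, φ (f ω) - ∑ ω ∈ Ω, φ (permAvg S f ω)
    have hstep : ∀ i ∈ S, H ≤ (T - 2 * ∑ j ∈ S, D i j) / (2 * n) +
        (∑ j ∈ S, D i j) / (2 * (n + 1)) := by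
      intro i hi
      have h1 := ih (S.erase i) (by rw [Finset.card_erase_of_mem hi, hn]; rfl)
      have h2 := sum_permAvg_erase_sub_le hΩ htan hI hconv hf hi
      rw [hn] at h2
      push_cast at h2
      have h3 : ∑ a ∈ S.erase i, ∑ b ∈ S.erase i, D a b = T - 2 * ∑ j ∈ S, D i j := by
        have hin : ∀ a, ∑ b ∈ S.erase i, D a b = ∑ b ∈ S, D a b - D a i := fun a => by
          rw [← Finset.add_sum_erase S _ hi]; ring
        simp only [hin]
        have := Finset.add_sum_erase S (fun a => ∑ b ∈ S, D a b - D a i) hi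
        rw [Finset.sum_sub_distrib (s := S), hDself] at this
        have h4 : ∑ a ∈ S, D a i = ∑ a ∈ S, D i a := Finset.sum_congr rfl fun a _ => hDcomm a i
        linarith
      rw [h3] at h1
      linarith
    have hsum := Finset.sum_le_sum hstep
    rw [Finset.sum_const, hn, nsmul_eq_mul, Finset.sum_add_distrib, ← Finset.sum_div,
      ← Finset.sum_div, Finset.sum_sub_distrib, Finset.sum_const, hn, nsmul_eq_mul,
      ← Finset.mul_sum, ← hT] at hsum
    push_cast at hsum ⊢
    rcases Nat.eq_zero_or_pos n with rfl | hpos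
    · simpa using hsum
    · have hn' : (0 : ℝ) < n := by exact_mod_cast hpos
      rw [le_div_iff₀ (by positivity)]
      have : ((n : ℝ) + 1) * H ≤ T * (n ^ 2 + n - 1 + 1) / (2 * n * (n + 1)) := by
        refine hsum.trans ?_
        rw [div_add_div _ _ (by positivity) (by positivity),
          div_le_div_iff₀ (by positivity) (by positivity)]
        have : 0 ≤ T * (n * (n + 1)) := by positivity
        nlinarith
      have h5 : T * ((n : ℝ) ^ 2 + n - 1 + 1) / (2 * n * (n + 1)) = T / 2 := by
        field_simp; ring
      linarith

end PermAvg

section RealInequalities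

/-- The tangent line inequality for `x ↦ x ^ (1 + s)` on the nonnegative reals. -/
lemma rpow_one_add_sub_le {s x y : ℝ} (hs : 0 < s) (hx : 0 ≤ x) (hy : 0 ≤ y) :
    x ^ (1 + s) - y ^ (1 + s) ≤ (1 + s) * x ^ s * (x - y) := by
  have h := Real.young_inequality_of_nonneg hy (Real.rpow_nonneg hx s)
    (p := 1 + s) (q := (1 + s) / s)
    (by rw [Real.holderConjugate_iff]; exact ⟨by linarith, by field_simp⟩)
  have h1 : (x ^ s) ^ ((1 + s) / s) = x ^ (1 + s) := by
    rw [← Real.rpow_mul hx]; congr 1; field_simp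
  have h2 : x ^ (1 + s) = x * x ^ s := by rw [Real.rpow_add_of_nonneg hx zero_le_one hs.le]; simp
  rw [h1] at h
  have h3 : (1 + s) * (y * x ^ s) ≤ y ^ (1 + s) + s * x ^ (1 + s) := by
    have h4 := mul_le_mul_of_nonneg_left h (by linarith : 0 ≤ 1 + s)
    refine h4.trans_eq ?_
    field_simp
  rw [h2] at h3 ⊢
  nlinarith

lemma rpow_sub_rpow_mul_sub_le {r u v : ℝ} (hr : 2 < r) (hu : 0 ≤ u) (hv : 0 ≤ v) :
    (u ^ (r - 1) - v ^ (r - 1)) * (u - v) ≤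
      (r - 1) * ((u ^ (r - 2) + v ^ (r - 2)) * (u - v) ^ 2) := by
  wlog h : v ≤ u generalizing u v
  · have := this hv hu (le_of_not_ge h)
    calc _ = (v ^ (r - 1) - u ^ (r - 1)) * (v - u) := by ring
      _ ≤ _ := this
      _ = _ := by ring
  have ht := rpow_one_add_sub_le (s := r - 2) (by linarith) hu hv
  rw [show 1 + (r - 2) = r - 1 by ring] at ht
  have h1 : 0 ≤ (r - 1) * v ^ (r - 2) * (u - v) ^ 2 :=
    mul_nonneg (mul_nonneg (by linarith) (Real.rpow_nonneg hv _)) (sq_nonneg _)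
  nlinarith [mul_le_mul_of_nonneg_right ht (sub_nonneg.2 h)]

/-- Joint convexity of `(d, z) ↦ d ^ 2 * z ^ (s - 1)`. -/
lemma sq_mul_rpow_combo_le {s a b d₁ d₂ z₁ z₂ : ℝ} (hs0 : 0 ≤ s) (hs1 : s ≤ 1) (ha : 0 ≤ a)
    (hb : 0 ≤ b) (hab : a + b = 1) (hz₁ : 0 < z₁) (hz₂ : 0 < z₂) :
    (a * d₁ + b * d₂) ^ 2 * (a * z₁ + b * z₂) ^ (s - 1) ≤
      a * (d₁ ^ 2 * z₁ ^ (s - 1)) + b * (d₂ ^ 2 * z₂ ^ (s - 1)) := by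
  have hconc := (Real.concaveOn_rpow (p := 1 - s) (by linarith) (by linarith)).2
    (Set.mem_Ici.2 hz₁.le) (Set.mem_Ici.2 hz₂.le) ha hb hab
  simp only [smul_eq_mul] at hconc
  have hz : 0 < a * z₁ + b * z₂ := by
    rcases ha.eq_or_lt with rfl | ha'
    · have : b = 1 := by linarith
      simpa [this] using hz₂
    · have := mul_pos ha' hz₁
      have := mul_nonneg hb hz₂.le
      linarith
  have hneg : ∀ z : ℝ, 0 < z → z ^ (s - 1) = (z ^ (1 - s))⁻¹ := fun z hz => by
    rw [← Real.rpow_neg hz.le, neg_sub]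
  rw [hneg _ hz, hneg _ hz₁, hneg _ hz₂]
  have hw₁ : 0 < z₁ ^ (1 - s) := Real.rpow_pos_of_pos hz₁ _
  have hw₂ : 0 < z₂ ^ (1 - s) := Real.rpow_pos_of_pos hz₂ _
  have hw : 0 < (a * z₁ + b * z₂) ^ (1 - s) := Real.rpow_pos_of_pos hz _
  set w₁ := z₁ ^ (1 - s)
  set w₂ := z₂ ^ (1 - s)
  set w := (a * z₁ + b * z₂) ^ (1 - s)
  rw [← div_eq_mul_inv, div_le_iff₀ hw]
  have hmono : (a * (d₁ ^ 2 * w₁⁻¹) + b * (d₂ ^ 2 * w₂⁻¹)) * (a * w₁ + b * w₂) ≤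
      (a * (d₁ ^ 2 * w₁⁻¹) + b * (d₂ ^ 2 * w₂⁻¹)) * w :=
    mul_le_mul_of_nonneg_left hconc (by positivity)
  refine le_trans ?_ hmono
  have hid : (a * (d₁ ^ 2 * w₁⁻¹) + b * (d₂ ^ 2 * w₂⁻¹)) * (a * w₁ + b * w₂) -
      (a * d₁ + b * d₂) ^ 2 = a * b * (d₁ * w₂ - d₂ * w₁) ^ 2 / (w₁ * w₂) := by
    field_simp
    ring
  have : 0 ≤ a * b * (d₁ * w₂ - d₂ * w₁) ^ 2 / (w₁ * w₂) := by positivity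
  linarith

lemma segment_pos {x y t : ℝ} (hx : 0 < x) (hy : 0 < y) (ht : t ∈ Set.Icc (0 : ℝ) 1) :
    0 < y + t * (x - y) := by
  have h := (convex_Ioi (0 : ℝ)) hy hx (sub_nonneg.2 ht.2) ht.1 (by ring)
  simp only [smul_eq_mul, Set.mem_Ioi] at h
  linarith

lemma continuousOn_sq_mul_rpow {s x y : ℝ} (hx : 0 < x) (hy : 0 < y) :
    ContinuousOn (fun t : ℝ => (x - y) ^ 2 * (y + t * (x - y)) ^ (s - 1))
      (Set.uIcc (0 : ℝ) 1) := by
  rw [Set.uIcc_of_le zero_le_one]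
  refine continuousOn_const.mul (ContinuousOn.rpow_const (by fun_prop) fun t ht => ?_)
  exact Or.inl (segment_pos hx hy ht).ne'

lemma rpow_sub_rpow_mul_sub_eq_integral {s x y : ℝ} (hx : 0 < x) (hy : 0 < y) :
    (x ^ s - y ^ s) * (x - y) =
      s * ∫ t in (0 : ℝ)..1, (x - y) ^ 2 * (y + t * (x - y)) ^ (s - 1) := by
  have h := intervalIntegral.integral_eq_sub_of_hasDerivAt (a := (0 : ℝ)) (b := 1)
    (f := fun t => (x - y) * (y + t * (x - y)) ^ s)
    (f' := fun t => s * ((x - y) ^ 2 * (y + t * (x - y)) ^ (s - 1))) ?_ ?_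
  · rw [← intervalIntegral.integral_const_mul, h]
    simp only [one_mul, zero_mul, add_zero, add_sub_cancel]
    ring
  · intro t ht
    rw [Set.uIcc_of_le zero_le_one] at ht
    have h1 : HasDerivAt (fun t : ℝ => y + t * (x - y)) (x - y) t := by
      simpa using ((hasDerivAt_id t).mul_const (x - y)).const_add y
    refine ((h1.rpow_const (p := s) (Or.inl (segment_pos hx hy ht).ne')).const_mul
      (x - y)).congr_deriv ?_
    ring
  · exact ((continuousOn_sq_mul_rpow hx hy).const_smul s).intervalIntegrable

/-- Joint convexity of `(x, y) ↦ (x ^ s - y ^ s) * (x - y)` for `0 < s ≤ 1`. -/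
lemma convexOn_rpow_sub_rpow_mul_sub {s : ℝ} (hs0 : 0 < s) (hs1 : s ≤ 1) :
    ConvexOn ℝ (Set.Ici (0 : ℝ) ×ˢ Set.Ici (0 : ℝ))
      fun z : ℝ × ℝ => (z.1 ^ s - z.2 ^ s) * (z.1 - z.2) := by
  refine ⟨(convex_Ici 0).prod (convex_Ici 0), ?_⟩
  have hpos : ∀ x₁ y₁ x₂ y₂ a b : ℝ, 0 < x₁ → 0 < y₁ → 0 < x₂ → 0 < y₂ → 0 ≤ a → 0 ≤ b →
      a + b = 1 → ((a * x₁ + b * x₂) ^ s - (a * y₁ + b * y₂) ^ s) *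
        ((a * x₁ + b * x₂) - (a * y₁ + b * y₂)) ≤
      a * ((x₁ ^ s - y₁ ^ s) * (x₁ - y₁)) + b * ((x₂ ^ s - y₂ ^ s) * (x₂ - y₂)) := by
    intro x₁ y₁ x₂ y₂ a b hx₁ hy₁ hx₂ hy₂ ha hb hab
    have hx : 0 < a * x₁ + b * x₂ := (convex_Ioi (0 : ℝ)) hx₁ hx₂ ha hb hab
    have hy : 0 < a * y₁ + b * y₂ := (convex_Ioi (0 : ℝ)) hy₁ hy₂ ha hb hab
    rw [rpow_sub_rpow_mul_sub_eq_integral hx hy, rpow_sub_rpow_mul_sub_eq_integral hx₁ hy₁,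
      rpow_sub_rpow_mul_sub_eq_integral hx₂ hy₂]
    have hi := (continuousOn_sq_mul_rpow (s := s) hx hy).intervalIntegrable
      (μ := MeasureTheory.volume)
    have hi₁ := (continuousOn_sq_mul_rpow (s := s) hx₁ hy₁).intervalIntegrable
      (μ := MeasureTheory.volume)
    have hi₂ := (continuousOn_sq_mul_rpow (s := s) hx₂ hy₂).intervalIntegrable
      (μ := MeasureTheory.volume)
    have hmono := intervalIntegral.integral_mono_on zero_le_one hi
      ((hi₁.const_mul a).add (hi₂.const_mul b)) fun t ht => by
        have h := sq_mul_rpow_combo_le (d₁ := x₁ - y₁) (d₂ := x₂ - y₂) hs0.le hs1 ha hb hab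
          (segment_pos hx₁ hy₁ ht) (segment_pos hx₂ hy₂ ht)
        rw [show a * (x₁ - y₁) + b * (x₂ - y₂) = a * x₁ + b * x₂ - (a * y₁ + b * y₂) by ring,
          show a * (y₁ + t * (x₁ - y₁)) + b * (y₂ + t * (x₂ - y₂)) =
            a * y₁ + b * y₂ + t * (a * x₁ + b * x₂ - (a * y₁ + b * y₂)) by ring] at h
        exact h
    rw [intervalIntegral.integral_add (hi₁.const_mul a) (hi₂.const_mul b),
      intervalIntegral.integral_const_mul a, intervalIntegral.integral_const_mul b] at hmono
    refine (mul_le_mul_of_nonneg_left hmono hs0.le).trans_eq ?_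
    ring
  rintro ⟨x₁, y₁⟩ ⟨hx₁, hy₁⟩ ⟨x₂, y₂⟩ ⟨hx₂, hy₂⟩ a b ha hb hab
  simp only [Set.mem_Ici] at hx₁ hy₁ hx₂ hy₂
  simp only [Prod.smul_mk, Prod.mk_add_mk, smul_eq_mul]
  have hcont := Real.continuous_rpow_const hs0.le
  have hc : ∀ c d : ℝ, Continuous fun ε : ℝ => ((c + ε) ^ s - (d + ε) ^ s) * (c - d) :=
    fun c d => ((hcont.comp (continuous_const.add continuous_id)).sub
      (hcont.comp (continuous_const.add continuous_id))).mul continuous_const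
  have hlim : ∀ F : ℝ → ℝ, Continuous F →
      Filter.Tendsto F (nhdsWithin 0 (Set.Ioi 0)) (nhds (F 0)) :=
    fun F hF => (hF.tendsto 0).mono_left nhdsWithin_le_nhds
  have key := le_of_tendsto_of_tendsto
    (hlim _ (hc (a * x₁ + b * x₂) (a * y₁ + b * y₂)))
    (hlim _ (((hc x₁ y₁).const_mul a).add ((hc x₂ y₂).const_mul b))) ?_
  · simpa using key
  · filter_upwards [self_mem_nhdsWithin] with ε hε
    have hε : 0 < ε := hε
    have h := hpos (x₁ + ε) (y₁ + ε) (x₂ + ε) (y₂ + ε) a b (by linarith) (by linarith)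
      (by linarith) (by linarith) ha hb hab
    have e : ∀ c d : ℝ, a * (c + ε) + b * (d + ε) = a * c + b * d + ε := fun c d => by
      linear_combination ε * hab
    rw [e, e] at h
    simpa only [add_sub_add_right_eq_sub, Pi.add_apply] using h

end RealInequalities

section UniformExpectation

variable {X : Type*} {Ω : Finset X}

lemma uexpect_mono {g h : X → ℝ} (hgh : ∀ ω ∈ Ω, g ω ≤ h ω) : uexpect Ω g ≤ uexpect Ω h := by
  unfold uexpect
  gcongr with ω hω
  exact hgh ω hω

lemma uexpect_nonneg {g : X → ℝ} (hg : ∀ ω ∈ Ω, 0 ≤ g ω) : 0 ≤ uexpect Ω g :=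
  div_nonneg (Finset.sum_nonneg hg) (Nat.cast_nonneg _)

lemma uexpect_add (g h : X → ℝ) :
    uexpect Ω (fun ω => g ω + h ω) = uexpect Ω g + uexpect Ω h := by
  simp [uexpect, Finset.sum_add_distrib, add_div]

lemma uexpect_const_mul (c : ℝ) (g : X → ℝ) :
    uexpect Ω (fun ω => c * g ω) = c * uexpect Ω g := by
  simp [uexpect, ← Finset.mul_sum, mul_div_assoc]

lemma uexpect_sub_const (hΩ : Ω.Nonempty) (g : X → ℝ) (c : ℝ) :
    uexpect Ω (fun ω => g ω - c) = uexpect Ω g - c := by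
  have : (Ω.card : ℝ) ≠ 0 := by exact_mod_cast hΩ.card_pos.ne'
  simp only [uexpect, Finset.sum_sub_distrib, Finset.sum_const, nsmul_eq_mul]
  field_simp

/-- Comparison of moments: an `L^b` bound implies the `L^a` bound for `a ≤ b`. -/
lemma uexpect_rpow_le_of_le (hΩ : Ω.Nonempty) {g : X → ℝ} (hg : ∀ ω ∈ Ω, 0 ≤ g ω)
    {a b K : ℝ} (ha : 0 < a) (hab : a ≤ b) (hK : 0 ≤ K)
    (h : uexpect Ω (fun ω => g ω ^ b) ≤ K ^ b) : uexpect Ω (fun ω => g ω ^ a) ≤ K ^ a := by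
  have hcard : (Ω.card : ℝ) ≠ 0 := by exact_mod_cast hΩ.card_pos.ne'
  have hpow : ∀ x : ℝ, 0 ≤ x → (x ^ a) ^ (b / a) = x ^ b := fun x hx => by
    rw [← Real.rpow_mul hx]; congr 1; field_simp
  have hE : ∀ k : X → ℝ, uexpect Ω k = ∑ ω ∈ Ω, (Ω.card : ℝ)⁻¹ * k ω := fun k => by
    rw [uexpect, ← Finset.mul_sum, div_eq_inv_mul]
  have hj := Real.rpow_arith_mean_le_arith_mean_rpow Ω (fun _ => (Ω.card : ℝ)⁻¹)
    (fun ω => g ω ^ a) (fun _ _ => by positivity) (by simp [hcard])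
    (fun ω hω => Real.rpow_nonneg (hg ω hω) a) (p := b / a) ((one_le_div ha).2 hab)
  rw [← hE, ← hE] at hj
  have hEnn : 0 ≤ uexpect Ω fun ω => g ω ^ a :=
    uexpect_nonneg fun ω hω => Real.rpow_nonneg (hg ω hω) a
  refine (Real.rpow_le_rpow_iff hEnn (Real.rpow_nonneg hK a)
    (div_pos (ha.trans_le hab) ha)).1 ?_
  rw [hpow K hK]
  exact hj.trans ((uexpect_mono fun ω hω => (hpow _ (hg ω hω)).le).trans h)

/-- A recursive inequality between consecutive moments implies moment growth of order `√p`. -/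
lemma uexpect_rpow_le_of_recursion (hΩ : Ω.Nonempty) {u V : X → ℝ}
    (hu : ∀ ω ∈ Ω, 0 ≤ u ω) (hV : ∀ ω ∈ Ω, 0 ≤ V ω)
    (h2 : uexpect Ω (fun ω => u ω ^ (2 : ℝ)) ≤ 4 * uexpect Ω V)
    (hrec : ∀ r : ℝ, 2 < r → uexpect Ω (fun ω => u ω ^ r) ≤
      uexpect Ω (fun ω => u ω ^ (r - 1)) ^ (r / (r - 1)) +
        4 * r * uexpect Ω (fun ω => u ω ^ (r - 2) * V ω))
    {θ : ℝ} (hθ : 1 < θ) (hθe : 1 - 1 / θ = Real.exp (-(1 / 2)))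
    {p A : ℝ} (hp : 2 ≤ p) (hA : 0 < A)
    (hVA : uexpect Ω (fun ω => V ω ^ (p / 2)) ≤ A ^ (p / 2)) :
    uexpect Ω (fun ω => u ω ^ p) ≤ (4 * θ * p * A) ^ (p / 2) := by
  have hVr : ∀ r : ℝ, 0 < r → r ≤ p → uexpect Ω (fun ω => V ω ^ (r / 2)) ≤ A ^ (r / 2) :=
    fun r hr hrp => uexpect_rpow_le_of_le hΩ hV (by linarith) (by linarith) hA.le hVA
  have hθ0 : 0 < θ := by linarith
  have main : ∀ n : ℕ, ∀ r : ℝ, 1 ≤ r → r ≤ n + 2 → r ≤ p →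
      uexpect Ω (fun ω => u ω ^ r) ≤ (4 * θ * r * A) ^ (r / 2) := by
    intro n
    induction n with
    | zero =>
      intro r hr1 hr2 hrp
      have hr2 : r ≤ 2 := by simpa using hr2
      have hEV : uexpect Ω V ≤ A := by simpa using hVr 2 two_pos hp
      have h := uexpect_rpow_le_of_le hΩ (g := fun ω => u ω ^ (2 : ℝ)) (a := r / 2) (b := 1)
        (K := 4 * A) (fun ω hω => Real.rpow_nonneg (hu ω hω) _) (by linarith) (by linarith)
        (by positivity) (by simp only [Real.rpow_one]; linarith)
      calc uexpect Ω (fun ω => u ω ^ r)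
          ≤ uexpect Ω (fun ω => (u ω ^ (2 : ℝ)) ^ (r / 2)) := uexpect_mono fun ω hω => by
            rw [← Real.rpow_mul (hu ω hω)]; exact le_of_eq (by congr 1; ring)
        _ ≤ (4 * A) ^ (r / 2) := h
        _ ≤ (4 * θ * r * A) ^ (r / 2) := by
            refine Real.rpow_le_rpow (by positivity) ?_ (by linarith)
            have : 1 ≤ θ * r := by nlinarith
            nlinarith
    | succ n ih =>
      intro r hr1 hrn hrp
      push_cast at hrn
      rcases le_or_gt r 2 with hr2 | hr2
      · exact ih r hr1 (by have := Nat.cast_nonneg (α := ℝ) n; linarith) hrp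
      have hr0 : 0 < r := by linarith
      set K := 4 * θ * r * A with hK
      have hK0 : 0 < K := by positivity
      have hlow := ih (r - 1) (by linarith) (by linarith) (by linarith)
      have hfirst : uexpect Ω (fun ω => u ω ^ (r - 1)) ^ (r / (r - 1)) ≤
          K ^ (r / 2) * (1 - 1 / θ) := by
        have hr1' : 0 < r - 1 := by linarith
        have hKr : 4 * θ * (r - 1) * A = K * (1 - 1 / r) := by rw [hK]; field_simp
        have hle : 0 ≤ 1 - 1 / r := by rw [sub_nonneg, div_le_one hr0]; linarith
        calc _ ≤ ((4 * θ * (r - 1) * A) ^ ((r - 1) / 2)) ^ (r / (r - 1)) :=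
              Real.rpow_le_rpow (uexpect_nonneg fun ω hω => Real.rpow_nonneg (hu ω hω) _) hlow
                (by positivity)
          _ = K ^ (r / 2) * (1 - 1 / r) ^ (r / 2) := by
              rw [← Real.rpow_mul (by positivity), hKr, ← Real.mul_rpow hK0.le hle]
              congr 1; field_simp
          _ ≤ K ^ (r / 2) * (1 - 1 / θ) := by
              refine mul_le_mul_of_nonneg_left ?_ (by positivity)
              rw [hθe]
              calc (1 - 1 / r) ^ (r / 2) ≤ Real.exp (-(1 / r)) ^ (r / 2) :=
                    Real.rpow_le_rpow hle (Real.one_sub_le_exp_neg _) (by positivity)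
                _ = Real.exp (-(1 / 2)) := by
                    rw [← Real.exp_mul]; congr 1; field_simp
      have hpt : ∀ ω ∈ Ω, 4 * r * (u ω ^ (r - 2) * V ω) ≤
          1 / θ * ((r - 2) / r) * u ω ^ r +
            1 / θ * (2 / r) * (K ^ (r / 2) / A ^ (r / 2)) * V ω ^ (r / 2) := by
        intro ω hω
        have hu0 := hu ω hω
        have hV0 := hV ω hω
        have h := Real.geom_mean_le_arith_mean2_weighted (w₁ := (r - 2) / r) (w₂ := 2 / r)
          (p₁ := u ω ^ r / K ^ (r / 2)) (p₂ := V ω ^ (r / 2) / A ^ (r / 2))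
          (div_nonneg (by linarith) hr0.le) (by positivity) (by positivity) (by positivity)
          (by field_simp; ring)
        rw [Real.div_rpow (by positivity) (by positivity),
          Real.div_rpow (by positivity) (by positivity), ← Real.rpow_mul hu0,
          ← Real.rpow_mul hK0.le, ← Real.rpow_mul hV0, ← Real.rpow_mul hA.le,
          show r * ((r - 2) / r) = r - 2 by field_simp,
          show r / 2 * ((r - 2) / r) = r / 2 - 1 by field_simp,
          show r / 2 * (2 / r) = 1 by field_simp, Real.rpow_one, Real.rpow_one,
          Real.rpow_sub hK0, Real.rpow_one] at h
        have hKp : 0 < K ^ (r / 2) := by positivity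
        have hm := mul_le_mul_of_nonneg_left h
          (by positivity : 0 ≤ K ^ (r / 2) / θ)
        calc 4 * r * (u ω ^ (r - 2) * V ω)
            = K ^ (r / 2) / θ * (u ω ^ (r - 2) / (K ^ (r / 2) / K) * (V ω / A)) := by
              rw [div_div_eq_mul_div, hK]; field_simp
          _ ≤ _ := hm
          _ = _ := by field_simp
      have hsecond : 4 * r * uexpect Ω (fun ω => u ω ^ (r - 2) * V ω) ≤
          1 / θ * ((r - 2) / r) * uexpect Ω (fun ω => u ω ^ r) +
            1 / θ * (2 / r) * K ^ (r / 2) := by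
        rw [← uexpect_const_mul]
        refine (uexpect_mono hpt).trans ?_
        rw [uexpect_add, uexpect_const_mul, uexpect_const_mul]
        have hAp : 0 < A ^ (r / 2) := by positivity
        have := mul_le_mul_of_nonneg_left (hVr r hr0 hrp)
          (by positivity : 0 ≤ 1 / θ * (2 / r) * (K ^ (r / 2) / A ^ (r / 2)))
        rw [show 1 / θ * (2 / r) * (K ^ (r / 2) / A ^ (r / 2)) * A ^ (r / 2) =
          1 / θ * (2 / r) * K ^ (r / 2) by field_simp] at this
        linarith
      have htotal := (hrec r hr2).trans (add_le_add hfirst hsecond)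
      have hθ1 : 1 / θ < 1 := by rw [div_lt_one hθ0]; exact hθ
      have hw : (r - 2) / r = 1 - 2 / r := by field_simp
      have hcoef : 0 < 1 - 1 / θ * ((r - 2) / r) := by
        have h1 : 0 < 1 / θ := by positivity
        have h2 : 0 < 2 / r := by positivity
        rw [hw]; nlinarith
      refine le_of_mul_le_mul_left ?_ hcoef
      rw [hw] at htotal ⊢
      linarith
  obtain ⟨n, hn⟩ := exists_nat_ge p
  exact main n p (by linarith) (by linarith) le_rfl

end UniformExpectation

section Multislice

lemma comp_perm_mem_multislice {L N : ℕ} {κ : Fin L → ℕ} {x : Fin L → ℝ} :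
    ∀ ω ∈ multislice L N κ x, ∀ σ : Equiv.Perm (Fin N), ω ∘ σ ∈ multislice L N κ x := by
  intro ω hω σ
  simp only [multislice, Finset.mem_filter, Fintype.mem_piFinset] at hω ⊢
  refine ⟨fun i => hω.1 (σ i), fun ℓ => ?_⟩
  rw [← hω.2 ℓ]
  exact Finset.card_bij' (fun i _ => σ i) (fun i _ => σ⁻¹ i) (by simp) (by simp) (by simp)
    (by simp)

lemma exists_perm_of_mem_multislice {L N : ℕ} {κ : Fin L → ℕ} {x : Fin L → ℝ}
    {ω ω' : Fin N → ℝ} (hω : ω ∈ multislice L N κ x) (hω' : ω' ∈ multislice L N κ x) :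
    ∃ σ : Equiv.Perm (Fin N), ω' = ω ∘ σ := by
  simp only [multislice, Finset.mem_filter, Fintype.mem_piFinset, Finset.mem_image,
    Finset.mem_univ, true_and] at hω hω'
  have hcard : ∀ y : ℝ, Fintype.card {i // ω' i = y} = Fintype.card {i // ω i = y} := by
    intro y
    simp only [Fintype.card_subtype]
    by_cases hy : ∃ ℓ, x ℓ = y
    · obtain ⟨ℓ, rfl⟩ := hy
      rw [hω.2, hω'.2]
    · rw [Finset.filter_false_of_mem, Finset.filter_false_of_mem]
      · rintro i - rfl
        exact hy (hω.1 i)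
      · rintro i - rfl
        exact hy (hω'.1 i)
  let e : ∀ y : ℝ, {i // ω' i = y} ≃ {i // ω i = y} := fun y => Fintype.equivOfCardEq (hcard y)
  refine ⟨(Equiv.sigmaFiberEquiv ω').symm.trans
    ((Equiv.sigmaCongrRight e).trans (Equiv.sigmaFiberEquiv ω)), ?_⟩
  ext i
  exact ((e (ω' i)) ⟨i, rfl⟩).2.symm

/-- Averaging over all permutations is the uniform expectation on the multislice. -/
lemma permAvg_univ_multislice {L N : ℕ} {κ : Fin L → ℕ} {x : Fin L → ℝ}
    (f : (Fin N → ℝ) → ℝ) {ω : Fin N → ℝ} (hω : ω ∈ multislice L N κ x) :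
    permAvg Finset.univ f ω = uexpect (multislice L N κ x) f := by
  have hperm : permsOn (Finset.univ : Finset (Fin N)) = Finset.univ := by
    ext; simp [mem_permsOn]
  have hconst : ∀ ω' ∈ multislice L N κ x,
      permAvg Finset.univ f ω' = permAvg Finset.univ f ω := by
    intro ω' hω'
    obtain ⟨ρ, rfl⟩ := exists_perm_of_mem_multislice hω hω'
    simp only [permAvg, hperm]
    congr 1
    exact Fintype.sum_equiv (Equiv.mulLeft ρ) _ _ fun σ => rfl
  have hsum : ∑ ω' ∈ multislice L N κ x, permAvg Finset.univ f ω' =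
      ∑ ω' ∈ multislice L N κ x, f ω' := by
    simp only [permAvg]
    rw [← Finset.sum_div, Finset.sum_comm, Finset.sum_congr rfl fun σ _ =>
      sum_comp_perm comp_perm_mem_multislice σ f, Finset.sum_const, nsmul_eq_mul]
    field_simp [(card_permsOn_pos (Finset.univ : Finset (Fin N))).ne']
  have hcard : ((multislice L N κ x).card : ℝ) ≠ 0 := by
    exact_mod_cast (Finset.card_pos.2 ⟨ω, hω⟩).ne'
  rw [uexpect, ← hsum, Finset.sum_congr rfl hconst, Finset.sum_const, nsmul_eq_mul]
  field_simp

lemma gammaSq_nonneg {N : ℕ} (f : (Fin N → ℝ) → ℝ) (ω : Fin N → ℝ) : 0 ≤ gammaSq f ω :=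
  mul_nonneg (by positivity) (Finset.sum_nonneg fun _ _ => sq_nonneg _)

lemma gammaSq_mono {N : ℕ} {f g : (Fin N → ℝ) → ℝ} (h : ∀ ω ω', |f ω - f ω'| ≤ |g ω - g ω'|)
    (ω : Fin N → ℝ) : gammaSq f ω ≤ gammaSq g ω := by
  unfold gammaSq
  exact mul_le_mul_of_nonneg_left
    (Finset.sum_le_sum fun q _ => sq_le_sq.2 (h _ _)) (by positivity)

/-- The symmetrized Dirichlet form expressed through `gammaSq`. -/
lemma sum_sum_add_mul_sq_eq {N : ℕ} (hN : N ≠ 0) {Ω : Finset (Fin N → ℝ)}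
    (hΩ : ∀ ω ∈ Ω, ∀ σ : Equiv.Perm (Fin N), ω ∘ σ ∈ Ω) (c u : (Fin N → ℝ) → ℝ) :
    ∑ i, ∑ j, ∑ ω ∈ Ω, (c ω + c (ω ∘ Equiv.swap i j)) * (u ω - u (ω ∘ Equiv.swap i j)) ^ 2 =
      8 * N * ∑ ω ∈ Ω, c ω * gammaSq u ω := by
  set G : Fin N → Fin N → ℝ := fun i j =>
    ∑ ω ∈ Ω, c ω * (u ω - u (ω ∘ Equiv.swap i j)) ^ 2 with hG
  have hsymm : ∀ i j, ∑ ω ∈ Ω, (c ω + c (ω ∘ Equiv.swap i j)) *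
      (u ω - u (ω ∘ Equiv.swap i j)) ^ 2 = 2 * G i j := by
    intro i j
    have h := sum_comp_perm hΩ (Equiv.swap i j)
      fun ω => c ω * (u ω - u (ω ∘ Equiv.swap i j)) ^ 2
    have hinv : ∀ ω : Fin N → ℝ, (ω ∘ Equiv.swap i j) ∘ Equiv.swap i j = ω := by
      intro ω; ext a; simp
    simp only [hinv] at h
    rw [two_mul]
    simp only [hG]
    nth_rewrite 2 [← h]
    rw [← Finset.sum_add_distrib]
    exact Finset.sum_congr rfl fun ω _ => by ring
  have hsplit : ∑ i, ∑ j, G i j =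
      2 * ∑ q ∈ (Finset.univ : Finset (Fin N × Fin N)).filter (fun q => q.1 < q.2),
        G q.1 q.2 := by
    have hlt : ∑ q ∈ (Finset.univ : Finset (Fin N × Fin N)).filter (fun q => ¬ q.1 < q.2),
        G q.1 q.2 = ∑ q ∈ (Finset.univ : Finset (Fin N × Fin N)).filter (fun q => q.1 < q.2),
        G q.1 q.2 := by
      have hsub : ∑ q ∈ (Finset.univ : Finset (Fin N × Fin N)).filter (fun q => q.2 < q.1),
          G q.1 q.2 = ∑ q ∈ (Finset.univ : Finset (Fin N × Fin N)).filter
            (fun q => ¬ q.1 < q.2), G q.1 q.2 := by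
        refine Finset.sum_subset (fun q hq => ?_) fun q hq hq' => ?_
        · simp only [Finset.mem_filter, Finset.mem_univ, true_and] at hq ⊢
          exact hq.le.not_gt
        · simp only [Finset.mem_filter, Finset.mem_univ, true_and] at hq hq'
          have : q.1 = q.2 := le_antisymm (not_lt.1 hq') (not_lt.1 hq)
          simp [hG, this]
      rw [← hsub]
      exact Finset.sum_bij' (fun q _ => q.swap) (fun q _ => q.swap) (by simp) (by simp)
        (by simp) (by simp) fun q _ => by
          simp only [hG, Prod.fst_swap, Prod.snd_swap, Equiv.swap_comm q.1 q.2]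
    rw [← Finset.sum_product' (f := fun i j => G i j), Finset.univ_product_univ,
      ← Finset.sum_filter_add_sum_filter_not _ (fun q : Fin N × Fin N => q.1 < q.2), hlt,
      two_mul]
  have hgamma : ∑ q ∈ (Finset.univ : Finset (Fin N × Fin N)).filter (fun q => q.1 < q.2),
      G q.1 q.2 = 2 * N * ∑ ω ∈ Ω, c ω * gammaSq u ω := by
    simp only [hG]
    rw [Finset.sum_comm, Finset.mul_sum]
    refine Finset.sum_congr rfl fun ω _ => ?_
    rw [gammaSq, ← Finset.mul_sum]
    have : (N : ℝ) ≠ 0 := by exact_mod_cast hN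
    field_simp
  simp only [hsymm, ← Finset.mul_sum]
  rw [hsplit, hgamma]
  ring

/-- Poincaré inequality on the multislice. -/
lemma uexpect_sq_le {L N : ℕ} {κ : Fin L → ℕ} {x : Fin L → ℝ} (hN : N ≠ 0)
    {g : (Fin N → ℝ) → ℝ} (hg : uexpect (multislice L N κ x) g = 0) :
    uexpect (multislice L N κ x) (fun ω => g ω ^ 2) ≤
      4 * uexpect (multislice L N κ x) (gammaSq g) := by
  have hconv : ConvexOn ℝ ((Set.univ : Set ℝ) ×ˢ (Set.univ : Set ℝ))
      fun z : ℝ × ℝ => (2 * z.1 - 2 * z.2) * (z.1 - z.2) := by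
    refine ⟨convex_univ.prod convex_univ, ?_⟩
    rintro ⟨x₁, y₁⟩ - ⟨x₂, y₂⟩ - a b ha hb hab
    obtain rfl : b = 1 - a := by linarith
    simp only [Prod.smul_mk, Prod.mk_add_mk, smul_eq_mul]
    nlinarith [mul_nonneg (mul_nonneg ha hb) (sq_nonneg ((x₁ - y₁) - (x₂ - y₂)))]
  have h := sum_sub_sum_permAvg_le (φ := fun y => y ^ 2) (ψ := fun y => 2 * y)
    (comp_perm_mem_multislice (κ := κ) (x := x))
    (fun y _ z _ => by nlinarith [sq_nonneg (y - z)]) convex_univ hconv (f := g)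
    (fun _ _ => Set.mem_univ _) Finset.univ
  have hD := sum_sum_add_mul_sq_eq hN (comp_perm_mem_multislice (κ := κ) (x := x))
    (fun _ => 1) g
  have hzero : ∑ ω ∈ multislice L N κ x, permAvg Finset.univ g ω ^ 2 = 0 :=
    Finset.sum_eq_zero fun ω hω => by rw [permAvg_univ_multislice g hω, hg]; norm_num
  have hform : ∀ i j, ∑ ω ∈ multislice L N κ x, (2 * g ω - 2 * g (ω ∘ Equiv.swap i j)) *
      (g ω - g (ω ∘ Equiv.swap i j)) =
      ∑ ω ∈ multislice L N κ x, (1 + 1) * (g ω - g (ω ∘ Equiv.swap i j)) ^ 2 :=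
    fun i j => Finset.sum_congr rfl fun ω _ => by ring
  simp only [hform] at h
  rw [hD, hzero, Finset.card_univ, Fintype.card_fin] at h
  have hN' : (0 : ℝ) < N := by exact_mod_cast Nat.pos_of_ne_zero hN
  simp only [uexpect, ← mul_div_assoc]
  refine div_le_div_of_nonneg_right ?_ (Nat.cast_nonneg _)
  rw [sub_zero] at h
  refine h.trans_eq ?_
  field_simp
  ring

/-- Beckner type recursion between consecutive moments on the multislice. -/
lemma uexpect_rpow_le_add {L N : ℕ} {κ : Fin L → ℕ} {x : Fin L → ℝ} (hN : N ≠ 0)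
    (hne : (multislice L N κ x).Nonempty) {u : (Fin N → ℝ) → ℝ} (hu : ∀ ω, 0 ≤ u ω)
    {r : ℝ} (hr : 2 < r) :
    uexpect (multislice L N κ x) (fun ω => u ω ^ r) ≤
      uexpect (multislice L N κ x) (fun ω => u ω ^ (r - 1)) ^ (r / (r - 1)) +
        4 * r * uexpect (multislice L N κ x) (fun ω => u ω ^ (r - 2) * gammaSq u ω) := by
  have hr1 : 0 < r - 1 := by linarith
  set s := 1 / (r - 1) with hs
  have hs0 : 0 < s := by positivity
  have hs1 : s ≤ 1 := by rw [hs, div_le_one hr1]; linarith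
  have hq : 1 + s = r / (r - 1) := by rw [hs]; field_simp; ring
  have hpow : ∀ y : ℝ, 0 ≤ y → (y ^ (r - 1)) ^ s = y := fun y hy => by
    rw [← Real.rpow_mul hy, hs, mul_one_div_cancel hr1.ne', Real.rpow_one]
  have hpow' : ∀ y : ℝ, 0 ≤ y → (y ^ (r - 1)) ^ (1 + s) = y ^ r := fun y hy => by
    rw [← Real.rpow_mul hy, hq, mul_div_cancel₀ _ hr1.ne']
  have hconv : ConvexOn ℝ (Set.Ici (0 : ℝ) ×ˢ Set.Ici (0 : ℝ))
      fun z : ℝ × ℝ => ((1 + s) * z.1 ^ s - (1 + s) * z.2 ^ s) * (z.1 - z.2) := by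
    have hc := (convexOn_rpow_sub_rpow_mul_sub hs0 hs1).smul (by linarith : 0 ≤ 1 + s)
    refine hc.congr fun z _ => ?_
    simp only [smul_eq_mul]
    ring
  have h := sum_sub_sum_permAvg_le (φ := fun y => y ^ (1 + s)) (ψ := fun y => (1 + s) * y ^ s)
    (comp_perm_mem_multislice (κ := κ) (x := x))
    (fun y hy z hz => rpow_one_add_sub_le hs0 hy hz) (convex_Ici 0) hconv
    (f := fun ω => u ω ^ (r - 1)) (fun ω _ => Real.rpow_nonneg (hu ω) _) Finset.univ
  have hD := sum_sum_add_mul_sq_eq hN (comp_perm_mem_multislice (κ := κ) (x := x))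
    (fun ω => u ω ^ (r - 2)) u
  have hN' : (0 : ℝ) < N := by exact_mod_cast Nat.pos_of_ne_zero hN
  have hcard : (0 : ℝ) < (multislice L N κ x).card := by exact_mod_cast hne.card_pos
  have havg : ∑ ω ∈ multislice L N κ x,
      permAvg Finset.univ (fun ω => u ω ^ (r - 1)) ω ^ (1 + s) =
      (multislice L N κ x).card *
        uexpect (multislice L N κ x) (fun ω => u ω ^ (r - 1)) ^ (1 + s) := by
    rw [Finset.sum_congr rfl fun ω hω => by
      rw [permAvg_univ_multislice (fun ω => u ω ^ (r - 1)) hω], Finset.sum_const, nsmul_eq_mul]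
  have hform : ∀ i j : Fin N, ∑ ω ∈ multislice L N κ x,
      ((1 + s) * (u ω ^ (r - 1)) ^ s - (1 + s) * (u (ω ∘ Equiv.swap i j) ^ (r - 1)) ^ s) *
        (u ω ^ (r - 1) - u (ω ∘ Equiv.swap i j) ^ (r - 1)) ≤
      r * ∑ ω ∈ multislice L N κ x, (u ω ^ (r - 2) + u (ω ∘ Equiv.swap i j) ^ (r - 2)) *
        (u ω - u (ω ∘ Equiv.swap i j)) ^ 2 := by
    intro i j
    rw [Finset.mul_sum]
    refine Finset.sum_le_sum fun ω _ => ?_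
    rw [hpow _ (hu _), hpow _ (hu _)]
    have h1 := mul_le_mul_of_nonneg_left
      (rpow_sub_rpow_mul_sub_le hr (hu ω) (hu (ω ∘ Equiv.swap i j)))
      (by linarith : 0 ≤ 1 + s)
    rw [← mul_assoc (1 + s) (r - 1), hq, div_mul_cancel₀ _ hr1.ne', ← hq] at h1
    linarith
  have hsum := Finset.sum_le_sum fun i (_ : i ∈ (Finset.univ : Finset (Fin N))) =>
    Finset.sum_le_sum fun j (_ : j ∈ (Finset.univ : Finset (Fin N))) => hform i j
  simp only [← Finset.mul_sum] at hsum
  rw [hD] at hsum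
  have h' := h.trans (div_le_div_of_nonneg_right hsum (by positivity))
  simp only [hpow' _ (hu _)] at h'
  rw [havg, Finset.card_univ, Fintype.card_fin, hq] at h'
  set B := uexpect (multislice L N κ x) (fun ω => u ω ^ (r - 1)) ^ (r / (r - 1))
  simp only [uexpect]
  rw [← mul_div_assoc, ← sub_le_iff_le_add', le_div_iff₀ hcard, sub_mul,
    div_mul_cancel₀ _ hcard.ne', mul_comm B]
  refine h'.trans_eq ?_
  field_simp
  ring

end Multislice

/-- Moment estimate on the multislice:
`‖f − E_κ f‖_p ≤ √(4θp) ‖Γ(f)‖_p` with `θ = √e/(√e − 1)`. -/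
theorem stmt18 (L N : ℕ) (hL : 2 ≤ L) (κ : Fin L → ℕ) (hκ : ∀ ℓ, 1 ≤ κ ℓ)
    (hN : N = ∑ ℓ, κ ℓ) (x : Fin L → ℝ) (hx : StrictMono x)
    (f : (Fin N → ℝ) → ℝ) (p : ℝ) (hp : 2 ≤ p) :
    (uexpect (multislice L N κ x)
        (fun ω => |f ω - uexpect (multislice L N κ x) f| ^ p)) ^ (1 / p) ≤
      Real.sqrt (4 * (Real.sqrt (Real.exp 1) / (Real.sqrt (Real.exp 1) - 1)) * p) *
        (uexpect (multislice L N κ x)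
          (fun ω => Real.sqrt (gammaSq f ω) ^ p)) ^ (1 / p) := by
  have hp0 : 0 < p := by linarith
  rcases (multislice L N κ x).eq_empty_or_nonempty with hempty | hne
  · simp [hempty, uexpect, hp0.ne']
  have hN0 : N ≠ 0 := by
    have h1 : κ ⟨0, by omega⟩ ≤ ∑ ℓ, κ ℓ :=
      Finset.single_le_sum (fun _ _ => Nat.zero_le _) (Finset.mem_univ _)
    have h2 := hκ ⟨0, by omega⟩
    omega
  set Ω := multislice L N κ x
  set θ := Real.sqrt (Real.exp 1) / (Real.sqrt (Real.exp 1) - 1) with hθdef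
  have hroot : Real.sqrt (Real.exp 1) = Real.exp (1 / 2) := by
    rw [Real.sqrt_eq_rpow, ← Real.exp_mul, one_mul]
  have hexp : 1 < Real.exp (1 / 2) := Real.one_lt_exp_iff.2 (by norm_num)
  have hθ : 1 < θ := by
    rw [hθdef, hroot, one_lt_div (by linarith)]
    linarith
  have hθe : 1 - 1 / θ = Real.exp (-(1 / 2)) := by
    rw [hθdef, hroot, Real.exp_neg]
    have : Real.exp (1 / 2) - 1 ≠ 0 := by linarith
    field_simp
    ring
  set g : (Fin N → ℝ) → ℝ := fun ω => f ω - uexpect Ω f with hg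
  have hgΓ : ∀ ω, gammaSq g ω = gammaSq f ω := fun ω => by simp [gammaSq, hg]
  have huΓ : ∀ ω, gammaSq (fun ω => |g ω|) ω ≤ gammaSq f ω := fun ω =>
    (gammaSq_mono (fun _ _ => abs_abs_sub_abs_le _ _) ω).trans_eq (hgΓ ω)
  have hg0 : uexpect Ω g = 0 := by rw [hg, uexpect_sub_const hne, sub_self]
  have hmom : ∀ A : ℝ, 0 < A → uexpect Ω (fun ω => gammaSq f ω ^ (p / 2)) ≤ A ^ (p / 2) →
      uexpect Ω (fun ω => |g ω| ^ p) ≤ (4 * θ * p * A) ^ (p / 2) := by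
    intro A hA hVA
    refine uexpect_rpow_le_of_recursion hne (fun ω _ => abs_nonneg (g ω))
      (fun ω _ => gammaSq_nonneg f ω) ?_ (fun r hr => ?_) hθ hθe hp hA hVA
    · have h := uexpect_sq_le hN0 hg0
      simp only [Real.rpow_two, sq_abs]
      simpa only [funext hgΓ] using h
    · refine (uexpect_rpow_le_add hN0 hne (fun ω => abs_nonneg (g ω)) hr).trans ?_
      gcongr
      exact uexpect_mono fun ω _ => mul_le_mul_of_nonneg_left (huΓ ω) (by positivity)
  have hsqrt : ∀ y : ℝ, 0 ≤ y → Real.sqrt y ^ p = y ^ (p / 2) := fun y hy => by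
    rw [Real.sqrt_eq_rpow, ← Real.rpow_mul hy]
    congr 1
    ring
  simp only [hsqrt _ (gammaSq_nonneg f _)]
  set M := uexpect Ω (fun ω => gammaSq f ω ^ (p / 2))
  have hM0 : 0 ≤ M := uexpect_nonneg fun ω _ => Real.rpow_nonneg (gammaSq_nonneg f ω) _
  set B := M ^ (1 / p) with hB
  have hB0 : 0 ≤ B := Real.rpow_nonneg hM0 _
  have hc : 0 < Real.sqrt (4 * θ * p) := Real.sqrt_pos.2 (by positivity)
  have hbound : ∀ ε > 0, uexpect Ω (fun ω => |g ω| ^ p) ^ (1 / p) ≤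
      Real.sqrt (4 * θ * p) * (B + ε) := by
    intro ε hε
    have hBε : 0 < B + ε := by positivity
    have hMle : M ≤ ((B + ε) ^ 2) ^ (p / 2) := by
      rw [← hsqrt _ (sq_nonneg _), Real.sqrt_sq hBε.le]
      calc M = B ^ p := by
            rw [hB, ← Real.rpow_mul hM0, one_div_mul_cancel hp0.ne', Real.rpow_one]
        _ ≤ (B + ε) ^ p := Real.rpow_le_rpow hB0 (by linarith) hp0.le
    have h := hmom _ (by positivity) hMle
    rw [← hsqrt _ (by positivity), Real.sqrt_mul (by positivity), Real.sqrt_sq hBε.le] at h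
    calc _ ≤ ((Real.sqrt (4 * θ * p) * (B + ε)) ^ p) ^ (1 / p) :=
          Real.rpow_le_rpow (uexpect_nonneg fun ω _ => by positivity) h (by positivity)
      _ = Real.sqrt (4 * θ * p) * (B + ε) := by
          rw [← Real.rpow_mul (by positivity), mul_one_div_cancel hp0.ne', Real.rpow_one]
  refine le_of_forall_pos_le_add fun δ hδ =>
    (hbound (δ / Real.sqrt (4 * θ * p)) (by positivity)).trans_eq ?_
  field_simp
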